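/- Let c > 0 be a real number and n ≥ 2 an integer. If n ≤ 2c/π − 1, then χ_n < c². If n ≥ 2c/π, then χ_n > c². -/

import Mathlib

open Real MeasureTheory Set

/-- A `k`-th prolate datum for band limit `c`: `ψ` is real-analytic with unit
`L²[-1,1]` norm, has exactly `k` zeros in `(-1,1)`, is an eigenfunction of the
prolate integral operator with nonzero eigenvalue `lam`, and satisfies the
prolate differential equation with eigenvalue `χ`. -/
structure ProlateDatum (c : ℝ) (k : ℕ) (ψ : ℝ → ℝ) (lam : ℂ) (χ : ℝ) : Prop where
  analytic : ∀ x : ℝ, AnalyticAt ℝ ψ x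
  normalized : ∫ t in (-1:ℝ)..1, (ψ t)^2 = 1
  zeros_card : {x : ℝ | x ∈ Set.Ioo (-1:ℝ) 1 ∧ ψ x = 0}.encard = k
  lam_ne_zero : lam ≠ 0
  integral_eig : ∀ x : ℝ,
    lam * (ψ x : ℂ) =
      ∫ t in (-1:ℝ)..1, (ψ t : ℂ) * Complex.exp (Complex.I * (c:ℂ) * (x:ℂ) * (t:ℂ))
  diff_eq : ∀ x : ℝ,
    (1 - x^2) * deriv (deriv ψ) x - 2*x * deriv ψ x + (χ - c^2 * x^2) * ψ x = 0

/-- derivative of the phase `arctan (y/c) + c x` -/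
lemma phase_deriv {c : ℝ} (hc : 0 < c) {y : ℝ → ℝ} {y' x : ℝ} (h : HasDerivAt y y' x) :
    HasDerivAt (fun x => arctan (y x / c) + c * x) ((y' + y x ^ 2 + c ^ 2) / (c * (1 + (y x / c) ^ 2))) x := by
  have h1 := (h.div_const c).arctan
  have h2 := h1.add ((hasDerivAt_id x).const_mul c)
  refine h2.congr_deriv ?_
  have : (1 + (y x / c) ^ 2) ≠ 0 := by positivity
  have : c ^ 2 + y x ^ 2 ≠ 0 := by positivity
  field_simp
  ring

/-- Riccati comparison: fast oscillation. -/
lemma riccati_short {c : ℝ} (hc : 0 < c) {a b : ℝ} (hab : a < b) {y y' : ℝ → ℝ}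
    (hy : ∀ x ∈ Ioo a b, HasDerivAt y (y' x) x)
    (hlt : ∀ x ∈ Ioo a b, y' x + y x ^ 2 < -c ^ 2) : c * (b - a) < π := by
  set F : ℝ → ℝ := fun x => arctan (y x / c) + c * x with hF
  have hanti : StrictAntiOn F (Ioo a b) := by
    apply strictAntiOn_of_deriv_neg (convex_Ioo a b)
    · intro x hx
      exact (phase_deriv hc (hy x hx)).continuousAt.continuousWithinAt
    · intro x hx
      rw [interior_Ioo] at hx
      rw [(phase_deriv hc (hy x hx)).deriv]
      apply div_neg_of_neg_of_pos
      · linarith [hlt x hx]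
      · positivity
  obtain ⟨s, hs1, hs2⟩ := exists_between hab
  obtain ⟨t, ht1, ht2⟩ := exists_between hs2
  have hst : F t < F s := hanti ⟨hs1, hs2⟩ ⟨by linarith, ht2⟩ ht1
  by_contra hcon
  push Not at hcon
  set d := F s - F t with hd
  have hdpos : 0 < d := by linarith
  -- pick points near the ends
  have hA : ∃ p, a < p ∧ p < s ∧ c * (p - a) < d / 2 := by
    refine ⟨a + min ((s - a) / 2) (d / (4 * c)), ?_, ?_, ?_⟩
    · have : 0 < min ((s - a) / 2) (d / (4 * c)) := lt_min (by linarith) (by positivity)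
      linarith
    · have := min_le_left ((s - a) / 2) (d / (4 * c)); linarith
    · have h1 := min_le_right ((s - a) / 2) (d / (4 * c))
      have h2 : c * min ((s - a) / 2) (d / (4 * c)) ≤ c * (d / (4 * c)) := by gcongr
      have h3 : c * (d / (4 * c)) = d / 4 := by field_simp
      rw [add_sub_cancel_left]; linarith
  have hB : ∃ q, t < q ∧ q < b ∧ c * (b - q) < d / 2 := by
    refine ⟨b - min ((b - t) / 2) (d / (4 * c)), ?_, ?_, ?_⟩
    · have := min_le_left ((b - t) / 2) (d / (4 * c)); linarith
    · have : 0 < min ((b - t) / 2) (d / (4 * c)) := lt_min (by linarith) (by positivity)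
      linarith
    · have h1 := min_le_right ((b - t) / 2) (d / (4 * c))
      have h2 : c * min ((b - t) / 2) (d / (4 * c)) ≤ c * (d / (4 * c)) := by gcongr
      have h3 : c * (d / (4 * c)) = d / 4 := by field_simp
      rw [sub_sub_cancel]; linarith
  obtain ⟨p, hp1, hp2, hp3⟩ := hA
  obtain ⟨q, hq1, hq2, hq3⟩ := hB
  have h1 : F s < F p := hanti ⟨hp1, by linarith⟩ ⟨hs1, hs2⟩ hp2
  have h2 : F q < F t := hanti ⟨by linarith, ht2⟩ ⟨by linarith, hq2⟩ hq1
  have h3 : F p < π / 2 + c * p := by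
    have := arctan_lt_pi_div_two (y p / c); simp only [hF]; linarith
  have h4 : -(π / 2) + c * q < F q := by
    have := neg_pi_div_two_lt_arctan (y q / c); simp only [hF]; linarith
  nlinarith

/-- Riccati comparison: slow oscillation. -/
lemma riccati_long {c : ℝ} (hc : 0 < c) {a b : ℝ} (hab : a < b) {v y y' : ℝ → ℝ}
    (hvc : ContinuousOn v (Icc a b)) (hva : v a = 0) (hvb : v b = 0)
    (hv0 : ∀ x ∈ Ioo a b, v x ≠ 0)
    (hv : ∀ x ∈ Ioo a b, HasDerivAt v (y x * v x) x)
    (hy : ∀ x ∈ Ioo a b, HasDerivAt y (y' x) x)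
    (hlt : ∀ x ∈ Ioo a b, -c ^ 2 < y' x + y x ^ 2) : π < c * (b - a) := by
  set F : ℝ → ℝ := fun x => arctan (y x / c) + c * x with hF
  have hmono : StrictMonoOn F (Ioo a b) := by
    apply strictMonoOn_of_deriv_pos (convex_Ioo a b)
    · intro x hx
      exact (phase_deriv hc (hy x hx)).continuousAt.continuousWithinAt
    · intro x hx
      rw [interior_Ioo] at hx
      rw [(phase_deriv hc (hy x hx)).deriv]
      apply div_pos
      · linarith [hlt x hx]
      · positivity
  have hder : ∀ M : ℝ, ∀ x ∈ Ioo a b,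
      HasDerivAt (fun t => v t ^ 2 * exp (M * t)) (v x ^ 2 * exp (M * x) * (2 * y x + M)) x := by
    intro M x hx
    have h1 := ((hv x hx).pow 2).mul (((hasDerivAt_id x).const_mul M).exp)
    refine h1.congr_deriv ?_
    simp
    ring
  have hcont : ∀ M : ℝ, ContinuousOn (fun t => v t ^ 2 * exp (M * t)) (Icc a b) := by
    intro M
    exact (hvc.pow 2).mul (by fun_prop)
  have key : ∀ δ : ℝ, 0 < δ → ∀ z : ℝ, arctan z ≤ π / 2 - δ → z ≤ tan (π / 2 - min δ (π / 4)) := by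
    intro δ hδ z hz
    have hp := pi_pos
    have h0 : 0 < min δ (π / 4) := lt_min hδ (by positivity)
    have h0' := min_le_right δ (π / 4)
    have h0'' := min_le_left δ (π / 4)
    have h1 : arctan z ≤ π / 2 - min δ (π / 4) := by linarith
    rw [← tan_arctan z]
    have := neg_pi_div_two_lt_arctan z
    rcases eq_or_lt_of_le h1 with h | h
    · rw [h]
    · exact (tan_lt_tan_of_lt_of_lt_pi_div_two this (by linarith) h).le
  have hleft : ∀ x ∈ Ioo a b, π / 2 + c * a ≤ F x := by
    intro x hx
    by_contra hcon
    push Not at hcon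
    set δ := π / 2 + c * a - F x with hδ
    have hδp : 0 < δ := by linarith
    set M := tan (π / 2 - min δ (π / 4)) with hM
    have hb : ∀ t ∈ Ioo a x, y t ≤ c * M := by
      intro t ht
      have h1 : F t < F x := hmono ⟨ht.1, by linarith [ht.2, hx.2]⟩ hx ht.2
      have h2 : arctan (y t / c) ≤ π / 2 - δ := by
        have : c * a < c * t := by have := ht.1; gcongr
        simp only [hF] at h1 hδ
        linarith
      have h3 := key δ hδp _ h2
      rw [div_le_iff₀ hc] at h3
      linarith
    have hanti : AntitoneOn (fun t => v t ^ 2 * exp (-(2 * (c * M)) * t)) (Icc a x) := by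
      apply antitoneOn_of_deriv_nonpos (convex_Icc a x)
      · exact (hcont _).mono (Icc_subset_Icc le_rfl hx.2.le)
      · intro t ht
        rw [interior_Icc] at ht
        exact (hder _ t ⟨ht.1, by linarith [ht.2, hx.2]⟩).differentiableAt.differentiableWithinAt
      · intro t ht
        rw [interior_Icc] at ht
        rw [(hder _ t ⟨ht.1, by linarith [ht.2, hx.2]⟩).deriv]
        apply mul_nonpos_of_nonneg_of_nonpos (by positivity)
        linarith [hb t ht]
    have h1 := hanti (left_mem_Icc.2 hx.1.le) (right_mem_Icc.2 hx.1.le) hx.1.le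
    simp only [hva] at h1
    have h2 : 0 < v x ^ 2 := by have := hv0 x hx; positivity
    have h3 := mul_pos h2 (exp_pos (-(2 * (c * M)) * x))
    rw [zero_pow two_ne_zero, zero_mul] at h1
    linarith
  have hright : ∀ x ∈ Ioo a b, F x ≤ -(π / 2) + c * b := by
    intro x hx
    by_contra hcon
    push Not at hcon
    set δ := F x - (-(π / 2) + c * b) with hδ
    have hδp : 0 < δ := by linarith
    set M := tan (π / 2 - min δ (π / 4)) with hM
    have hb : ∀ t ∈ Ioo x b, -y t ≤ c * M := by
      intro t ht
      have h1 : F x < F t := hmono hx ⟨by linarith [ht.1, hx.1], ht.2⟩ ht.1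
      have h2 : arctan (-y t / c) ≤ π / 2 - δ := by
        have : c * t < c * b := by have := ht.2; gcongr
        simp only [hF] at h1 hδ
        rw [neg_div, arctan_neg]
        linarith
      have h3 := key δ hδp _ h2
      rw [div_le_iff₀ hc] at h3
      linarith
    have hanti : MonotoneOn (fun t => v t ^ 2 * exp ((2 * (c * M)) * t)) (Icc x b) := by
      apply monotoneOn_of_deriv_nonneg (convex_Icc x b)
      · exact (hcont _).mono (Icc_subset_Icc hx.1.le le_rfl)
      · intro t ht
        rw [interior_Icc] at ht
        exact (hder _ t ⟨by linarith [ht.1, hx.1], ht.2⟩).differentiableAt.differentiableWithinAt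
      · intro t ht
        rw [interior_Icc] at ht
        rw [(hder _ t ⟨by linarith [ht.1, hx.1], ht.2⟩).deriv]
        apply mul_nonneg (by positivity)
        linarith [hb t ht]
    have h1 := hanti (left_mem_Icc.2 hx.2.le) (right_mem_Icc.2 hx.2.le) hx.2.le
    simp only [hvb] at h1
    have h2 : 0 < v x ^ 2 := by have := hv0 x hx; positivity
    have h3 := mul_pos h2 (exp_pos ((2 * (c * M)) * x))
    rw [zero_pow two_ne_zero, zero_mul] at h1
    linarith
  obtain ⟨s, hs1, hs2⟩ := exists_between hab
  obtain ⟨t, ht1, ht2⟩ := exists_between hs2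
  have hst : F s < F t := hmono ⟨hs1, hs2⟩ ⟨by linarith, ht2⟩ ht1
  have h1 := hleft s ⟨hs1, hs2⟩
  have h2 := hright t ⟨by linarith, ht2⟩
  nlinarith

/-- The nodal component around a nonzero point. -/
lemma exists_component {A B z : ℝ} {v : ℝ → ℝ} (hv : ContinuousOn v (Icc A B))
    (hz : z ∈ Ioo A B) (hA : v A = 0) (hB : v B = 0) (hvz : v z ≠ 0) :
    ∃ a b, A ≤ a ∧ a < b ∧ b ≤ B ∧ v a = 0 ∧ v b = 0 ∧ ∀ x ∈ Ioo a b, v x ≠ 0 := by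
  have hS : IsCompact (Icc A z ∩ v ⁻¹' {0}) := by
    have : ContinuousOn v (Icc A z) := hv.mono (Icc_subset_Icc le_rfl hz.2.le)
    exact isCompact_Icc.of_isClosed_subset
      (this.preimage_isClosed_of_isClosed isClosed_Icc isClosed_singleton) inter_subset_left
  have hT : IsCompact (Icc z B ∩ v ⁻¹' {0}) := by
    have : ContinuousOn v (Icc z B) := hv.mono (Icc_subset_Icc hz.1.le le_rfl)
    exact isCompact_Icc.of_isClosed_subset
      (this.preimage_isClosed_of_isClosed isClosed_Icc isClosed_singleton) inter_subset_left
  obtain ⟨a, ha, hamax⟩ := hS.exists_isGreatest ⟨A, ⟨⟨le_rfl, hz.1.le⟩, hA⟩⟩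
  obtain ⟨b, hb, hbmin⟩ := hT.exists_isLeast ⟨B, ⟨⟨hz.2.le, le_rfl⟩, hB⟩⟩
  have ha0 : v a = 0 := ha.2
  have hb0 : v b = 0 := hb.2
  have haz : a ≠ z := by rintro rfl; exact hvz ha0
  have hbz : z ≠ b := by rintro rfl; exact hvz hb0
  have haz' : a < z := lt_of_le_of_ne ha.1.2 haz
  have hbz' : z < b := lt_of_le_of_ne hb.1.1 hbz
  refine ⟨a, b, ha.1.1, by linarith, hb.1.2, ha0, hb0, ?_⟩
  intro x hx h0
  rcases le_total x z with h | h
  · have := hamax ⟨⟨by linarith [ha.1.1, hx.1], h⟩, h0⟩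
    linarith [hx.1]
  · have := hbmin ⟨⟨h, by linarith [hb.1.2, hx.2]⟩, h0⟩
    linarith [hx.2]

/-- solutions of the prolate equation, with derivatives as data -/
structure PSol (c χ : ℝ) (f f1 f2 : ℝ → ℝ) : Prop where
  d1 : ∀ x, HasDerivAt f (f1 x) x
  d2 : ∀ x, HasDerivAt f1 (f2 x) x
  eq : ∀ x, (1 - x ^ 2) * f2 x - 2 * x * f1 x + (χ - c ^ 2 * x ^ 2) * f x = 0

lemma PSol.refl {c χ : ℝ} {f f1 f2 : ℝ → ℝ} (h : PSol c χ f f1 f2) :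
    PSol c χ (fun x => f (-x)) (fun x => -f1 (-x)) (fun x => f2 (-x)) where
  d1 x := by
    have := (h.d1 (-x)).comp x (hasDerivAt_neg x)
    exact this.congr_deriv (by ring)
  d2 x := by
    have := ((h.d2 (-x)).comp x (hasDerivAt_neg x)).neg
    exact this.congr_deriv (by ring)
  eq x := by have := h.eq (-x); linear_combination this

lemma PSol.neg {c χ : ℝ} {f f1 f2 : ℝ → ℝ} (h : PSol c χ f f1 f2) :
    PSol c χ (fun x => -f x) (fun x => -f1 x) (fun x => -f2 x) where
  d1 x := (h.d1 x).neg
  d2 x := (h.d2 x).neg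
  eq x := by have := h.eq x; linear_combination -this

lemma PSol.w {c χ : ℝ} {f f1 f2 : ℝ → ℝ} (h : PSol c χ f f1 f2) (x : ℝ) :
    HasDerivAt (fun x => (1 - x ^ 2) * f1 x) (-((χ - c ^ 2 * x ^ 2) * f x)) x := by
  have h1 := ((hasDerivAt_pow 2 x).const_sub 1).mul (h.d2 x)
  refine h1.congr_deriv ?_
  have := h.eq x
  norm_num
  linear_combination this

/-- double zeros are impossible -/
lemma PSol.deriv_ne {c χ : ℝ} {f f1 f2 : ℝ → ℝ} (h : PSol c χ f f1 f2) {z : ℝ}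
    (hz : z ∈ Ioo (-1 : ℝ) 1) (hfin : {x : ℝ | x ∈ Ioo (-1 : ℝ) 1 ∧ f x = 0}.Finite)
    (h0 : f z = 0) : f1 z ≠ 0 := by
  intro h1
  obtain ⟨ρ, hρ1, hρ2⟩ := exists_between hz.2
  have hc2 : ContinuousOn (fun x => |2 * x / (1 - x ^ 2)| + |(χ - c ^ 2 * x ^ 2) / (1 - x ^ 2)|) (Icc z ρ) := by
    have : ∀ x ∈ Icc z ρ, (1 - x ^ 2) ≠ 0 := by
      intro x hx
      have := hz.1
      have : 0 < 1 - x ^ 2 := by nlinarith [hx.1, hx.2]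
      exact this.ne'
    apply ContinuousOn.add
    · exact (ContinuousOn.div (by fun_prop) (by fun_prop) this).abs
    · exact (ContinuousOn.div (by fun_prop) (by fun_prop) this).abs
  obtain ⟨K, hK⟩ := (isCompact_Icc.bddAbove_image hc2)
  have hK' : ∀ x ∈ Icc z ρ, |2 * x / (1 - x ^ 2)| + |(χ - c ^ 2 * x ^ 2) / (1 - x ^ 2)| ≤ K := by
    intro x hx
    exact hK ⟨x, hx, rfl⟩
  have hder : ∀ x, HasDerivAt (fun x => (f x ^ 2 + f1 x ^ 2) * exp (-(1 + 3 * K) * x))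
      ((2 * f x * f1 x + 2 * f1 x * f2 x - (1 + 3 * K) * (f x ^ 2 + f1 x ^ 2)) * exp (-(1 + 3 * K) * x)) x := by
    intro x
    have h1 := (((h.d1 x).pow 2).add ((h.d2 x).pow 2)).mul (((hasDerivAt_id x).const_mul (-(1 + 3 * K))).exp)
    refine h1.congr_deriv ?_
    simp
    ring
  have hanti : AntitoneOn (fun x => (f x ^ 2 + f1 x ^ 2) * exp (-(1 + 3 * K) * x)) (Icc z ρ) := by
    apply antitoneOn_of_deriv_nonpos (convex_Icc z ρ)
    · intro x _
      exact (hder x).continuousAt.continuousWithinAt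
    · intro x _
      exact (hder x).differentiableAt.differentiableWithinAt
    · intro x hx
      rw [interior_Icc] at hx
      rw [(hder x).deriv]
      apply mul_nonpos_of_nonpos_of_nonneg _ (exp_pos _).le
      have hb := hK' x ⟨hx.1.le, hx.2.le⟩
      have hp : 0 < 1 - x ^ 2 := by nlinarith [hx.1, hx.2, hz.1]
      set α := 2 * x / (1 - x ^ 2) with hα
      set β := (χ - c ^ 2 * x ^ 2) / (1 - x ^ 2) with hβ
      have hf2 : f2 x = α * f1 x - β * f x := by
        rw [hα, hβ]; field_simp; linear_combination h.eq x
      have hα1 : α ≤ K := by linarith [le_abs_self α, abs_nonneg β]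
      have hβ1 : |β| ≤ K := by linarith [abs_nonneg α]
      have hβ2 := abs_le.1 hβ1
      have hK0 : 0 ≤ K := by linarith [abs_nonneg β]
      rw [hf2]
      nlinarith [sq_nonneg (f x - f1 x), mul_nonneg (sub_nonneg.2 hα1) (sq_nonneg (f1 x)),
        mul_nonneg (sub_nonneg.2 hβ2.2) (sq_nonneg (f x - f1 x)),
        mul_nonneg (by linarith [hβ2.1] : 0 ≤ K + β) (sq_nonneg (f x + f1 x)),
        mul_nonneg hK0 (sq_nonneg (f x)), mul_nonneg hK0 (sq_nonneg (f1 x))]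
  have hzero : ∀ x ∈ Icc z ρ, f x = 0 := by
    intro x hx
    have := hanti (left_mem_Icc.2 hρ1.le) hx hx.1
    simp only [h0, h1] at this
    norm_num at this
    have h2 : f x ^ 2 + f1 x ^ 2 ≤ 0 := by
      by_contra hcon
      push Not at hcon
      have := mul_pos hcon (exp_pos ((-(3 * K) + -1) * x))
      have e : (-(3 * K) + -1) * x = (-1 + -(3 * K)) * x := by ring
      simp only [e] at *
      linarith
    nlinarith [sq_nonneg (f x), sq_nonneg (f1 x)]
  apply (Icc_infinite hρ1) (hfin.subset _)
  intro x hx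
  exact ⟨⟨by linarith [hz.1, hx.1], by linarith [hx.2]⟩, hzero x hx⟩

/-- critical point to the right of the last zero, when `χ < c²` -/
lemma PSol.exists_right_pos {c χ : ℝ} (hc : 0 < c) (hχ : χ < c ^ 2) {f f1 f2 : ℝ → ℝ}
    (h : PSol c χ f f1 f2) {z : ℝ}
    (hz : z ∈ Ioo (-1 : ℝ) 1) (h1 : f1 z ≠ 0) (h0 : f z = 0)
    (hpos : ∀ x ∈ Ioo z 1, 0 < f x) :
    ∃ R, z < R ∧ R < √χ / c ∧ f1 R = 0 := by
  set w : ℝ → ℝ := fun x => (1 - x ^ 2) * f1 x with hw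
  have hwc : Continuous w := continuous_iff_continuousAt.2 fun x => (h.w x).continuousAt
  have hw1 : w 1 = 0 := by simp [hw]
  have hf1z : 0 < f1 z := by
    apply lt_of_le_of_ne _ h1.symm
    by_contra hcon
    push Not at hcon
    have hs := (hasDerivAt_iff_tendsto_slope.1 (h.d1 z))
    have hs' := hs.mono_left (nhdsWithin_mono z (fun x (hx : x ∈ Ioi z) => (ne_of_gt hx : x ≠ z)))
    have : 0 ≤ f1 z := by
      apply ge_of_tendsto hs'
      filter_upwards [Ioo_mem_nhdsGT hz.2] with x hx
      rw [slope_def_field, h0]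
      have := hpos x hx
      have := hx.1
      apply div_nonneg <;> linarith
    linarith
  have hwz : 0 < w z := by
    have : 0 < 1 - z ^ 2 := by nlinarith [hz.1, hz.2]
    exact mul_pos this hf1z
  have hmono : ∀ T, z ≤ T → T < 1 → (∀ x ∈ Ioo T 1, χ - c ^ 2 * x ^ 2 < 0) → w T < w 1 := by
    intro T hT1 hT2 hr
    have : StrictMonoOn w (Icc T 1) := by
      apply strictMonoOn_of_deriv_pos (convex_Icc T 1) hwc.continuousOn
      intro x hx
      rw [interior_Icc] at hx
      rw [(h.w x).deriv]
      have := mul_pos_of_neg_of_neg (hr x hx) (neg_lt_zero.2 (hpos x ⟨by linarith [hx.1], hx.2⟩))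
      linarith
    exact this (left_mem_Icc.2 hT2.le) (right_mem_Icc.2 hT2.le) hT2
  -- the turning point lies to the right of z
  set T := √χ / c with hT
  have hT0 : 0 ≤ T := by positivity
  have hT1 : T < 1 := by
    rw [hT, div_lt_one hc, sqrt_lt' hc]; exact hχ
  have hrT : ∀ x, T < x → χ - c ^ 2 * x ^ 2 < 0 := by
    intro x hx
    have hx0 := hx
    rw [hT, div_lt_iff₀ hc, sqrt_lt' (mul_pos (lt_of_le_of_lt hT0 hx0) hc)] at hx
    linarith
  have hzT : z < T := by
    by_contra hcon
    push Not at hcon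
    have := hmono z le_rfl hz.2 (fun x hx => hrT x (by linarith [hx.1]))
    linarith
  have hwT : w T < 0 := by
    have := hmono T hzT.le hT1 (fun x hx => hrT x hx.1)
    linarith
  obtain ⟨R, hR, hwR⟩ := intermediate_value_Ioo' hzT.le hwc.continuousOn ⟨hwT, hwz⟩
  refine ⟨R, hR.1, hR.2, ?_⟩
  have hne : (1 - R ^ 2) ≠ 0 := by
    have : 0 < 1 - R ^ 2 := by nlinarith [hR.1, hR.2, hz.1]
    exact this.ne'
  exact (mul_eq_zero.1 hwR).resolve_left hne

lemma PSol.exists_right {c χ : ℝ} (hc : 0 < c) (hχ : χ < c ^ 2) {f f1 f2 : ℝ → ℝ}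
    (h : PSol c χ f f1 f2) {z : ℝ}
    (hz : z ∈ Ioo (-1 : ℝ) 1) (h1 : f1 z ≠ 0) (h0 : f z = 0)
    (hne : ∀ x ∈ Ioo z 1, f x ≠ 0) :
    ∃ R, z < R ∧ R < √χ / c ∧ f1 R = 0 := by
  have hfc : Continuous f := continuous_iff_continuousAt.2 fun x => (h.d1 x).continuousAt
  have hsign : (∀ x ∈ Ioo z 1, 0 < f x) ∨ (∀ x ∈ Ioo z 1, f x < 0) := by
    by_contra hcon
    push Not at hcon
    obtain ⟨⟨p, hp, hp0⟩, ⟨q, hq, hq0⟩⟩ := hcon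
    have := isPreconnected_Ioo.intermediate_value hp hq hfc.continuousOn ⟨hp0, hq0⟩
    obtain ⟨x, hx, hx0⟩ := this
    exact hne x hx hx0
  rcases hsign with hs | hs
  · exact h.exists_right_pos hc hχ hz h1 h0 hs
  · obtain ⟨R, h1, h2, h3⟩ := h.neg.exists_right_pos hc hχ hz (neg_ne_zero.2 h1) (by simp [h0])
      (fun x hx => neg_pos.2 (hs x hx))
    exact ⟨R, h1, h2, neg_eq_zero.1 h3⟩

/-- zero-free intervals are short when `χ ≥ c²` -/
lemma PSol.short {c χ : ℝ} (hc : 0 < c) (hχ : c ^ 2 ≤ χ) {f f1 f2 : ℝ → ℝ}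
    (h : PSol c χ f f1 f2) {a b : ℝ} (hab : a < b) (ha : -1 ≤ a) (hb : b ≤ 1)
    (hne : ∀ x ∈ Ioo a b, f x ≠ 0) : c * (b - a) < π := by
  apply riccati_short hc hab (y := fun x => f1 x / f x - x / (1 - x ^ 2))
    (y' := fun x => (f2 x * f x - f1 x * f1 x) / f x ^ 2 - (1 + x ^ 2) / (1 - x ^ 2) ^ 2)
  · intro x hx
    have hp : (1 - x ^ 2) ≠ 0 := by
      have : 0 < 1 - x ^ 2 := by nlinarith [hx.1, hx.2]
      exact this.ne'
    have h1 := ((h.d2 x).div (h.d1 x) (hne x hx)).sub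
      ((hasDerivAt_id x).div ((hasDerivAt_pow 2 x).const_sub 1) hp)
    refine h1.congr_deriv ?_
    simp
    ring
  · intro x hx
    have hp : 0 < 1 - x ^ 2 := by nlinarith [hx.1, hx.2]
    have hf := hne x hx
    have e : (f2 x * f x - f1 x * f1 x) / f x ^ 2 - (1 + x ^ 2) / (1 - x ^ 2) ^ 2
        + (f1 x / f x - x / (1 - x ^ 2)) ^ 2
        = -c ^ 2 - (χ - c ^ 2) / (1 - x ^ 2) - 1 / (1 - x ^ 2) ^ 2 := by
      have hf2 : f2 x = (2 * x * f1 x - (χ - c ^ 2 * x ^ 2) * f x) / (1 - x ^ 2) := by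
        field_simp; linear_combination h.eq x
      rw [hf2]
      field_simp
      ring
    have h1 : 0 ≤ (χ - c ^ 2) / (1 - x ^ 2) := div_nonneg (by linarith) hp.le
    have h2 : 0 < 1 / (1 - x ^ 2) ^ 2 := by positivity
    rw [e]
    linarith

/-- gaps of critical points are long when `χ ≤ c²` -/
lemma PSol.long {c χ : ℝ} (hc : 0 < c) (hχ : χ ≤ c ^ 2) {f f1 f2 : ℝ → ℝ}
    (h : PSol c χ f f1 f2) {a b z : ℝ} (ha : -1 ≤ a) (hb : b ≤ 1)
    (hr : ∀ x ∈ Ioo a b, 0 < χ - c ^ 2 * x ^ 2)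
    (hvc : ContinuousOn (fun x => (1 - x ^ 2) * f1 x / √(χ - c ^ 2 * x ^ 2)) (Icc a b))
    (hz : z ∈ Ioo a b) (hz1 : f1 z ≠ 0)
    (hva : (1 - a ^ 2) * f1 a / √(χ - c ^ 2 * a ^ 2) = 0)
    (hvb : (1 - b ^ 2) * f1 b / √(χ - c ^ 2 * b ^ 2) = 0) : π < c * (b - a) := by
  have hp : ∀ x ∈ Ioo a b, 0 < 1 - x ^ 2 := by
    intro x hx
    nlinarith [hx.1, hx.2]
  have hvz : (1 - z ^ 2) * f1 z / √(χ - c ^ 2 * z ^ 2) ≠ 0 :=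
    div_ne_zero (mul_ne_zero (hp z hz).ne' hz1) (sqrt_pos.2 (hr z hz)).ne'
  obtain ⟨a', b', ha', hab', hb', hva', hvb', hv0⟩ := exists_component hvc hz hva hvb hvz
  suffices π < c * (b' - a') by nlinarith
  have hsub : ∀ x ∈ Ioo a' b', x ∈ Ioo a b := fun x hx => ⟨by linarith [hx.1], by linarith [hx.2]⟩
  have hf1 : ∀ x ∈ Ioo a' b', f1 x ≠ 0 := by
    intro x hx h0
    exact hv0 x hx (by simp [h0])
  have hrd : ∀ x, HasDerivAt (fun x => χ - c ^ 2 * x ^ 2) (-(2 * c ^ 2 * x)) x := by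
    intro x
    refine (((hasDerivAt_pow 2 x).const_mul (c ^ 2)).const_sub χ).congr_deriv ?_
    norm_num
    ring
  apply riccati_long hc hab' (hvc.mono (Icc_subset_Icc ha' hb')) hva' hvb' hv0
    (y := fun x => -((χ - c ^ 2 * x ^ 2) * f x) / ((1 - x ^ 2) * f1 x) + c ^ 2 * x / (χ - c ^ 2 * x ^ 2))
    (y' := fun x => 2 * c ^ 2 * x * f x / ((1 - x ^ 2) * f1 x) - (χ - c ^ 2 * x ^ 2) / (1 - x ^ 2)
      - ((χ - c ^ 2 * x ^ 2) * f x / ((1 - x ^ 2) * f1 x)) ^ 2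
      + c ^ 2 / (χ - c ^ 2 * x ^ 2) + 2 * c ^ 4 * x ^ 2 / (χ - c ^ 2 * x ^ 2) ^ 2)
  · intro x hx
    have hr' := hr x (hsub x hx)
    have hp' := hp x (hsub x hx)
    have hf1' := hf1 x hx
    have hs := sqrt_pos.2 hr'
    have hss := sq_sqrt hr'.le
    refine ((h.w x).div ((hrd x).sqrt hr'.ne') hs.ne').congr_deriv ?_
    set s := √(χ - c ^ 2 * x ^ 2)
    rw [← hss]
    field_simp
    ring
  · intro x hx
    have hr' := hr x (hsub x hx)
    have hp' := hp x (hsub x hx)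
    have hf1' := hf1 x hx
    refine ((((hrd x).mul (h.d1 x)).neg.div (h.w x) (mul_ne_zero hp'.ne' hf1')).add
      (((hasDerivAt_id x).const_mul (c ^ 2)).div (hrd x) hr'.ne')).congr_deriv ?_
    simp only [id, Pi.mul_apply, Pi.neg_apply]
    generalize hrr : χ - c ^ 2 * x ^ 2 = r at *
    field_simp
    ring
  · intro x hx
    have hr' := hr x (hsub x hx)
    have hp' := hp x (hsub x hx)
    have hf1' := hf1 x hx
    have h1 : (χ - c ^ 2 * x ^ 2) / (1 - x ^ 2) ≤ c ^ 2 := by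
      rw [div_le_iff₀ hp']; linarith
    generalize hrr : χ - c ^ 2 * x ^ 2 = r at *
    have e : 2 * c ^ 2 * x * f x / ((1 - x ^ 2) * f1 x) - r / (1 - x ^ 2)
        - (r * f x / ((1 - x ^ 2) * f1 x)) ^ 2 + c ^ 2 / r + 2 * c ^ 4 * x ^ 2 / r ^ 2
        + (-(r * f x) / ((1 - x ^ 2) * f1 x) + c ^ 2 * x / r) ^ 2
        = -(r / (1 - x ^ 2)) + c ^ 2 / r + 3 * c ^ 4 * x ^ 2 / r ^ 2 := by
      field_simp
      ring
    rw [e]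
    have h2 : 0 < c ^ 2 / r := by positivity
    have h3 : 0 ≤ 3 * c ^ 4 * x ^ 2 / r ^ 2 := by positivity
    linarith

/-- counting -/
lemma PSol.count {c χ : ℝ} (hc : 0 < c) (hχ : χ ≤ c ^ 2) {f f1 f2 : ℝ → ℝ}
    (h : PSol c χ f f1 f2) {L : ℝ} (hL : -1 ≤ L)
    (hvL : (1 - L ^ 2) * f1 L / √(χ - c ^ 2 * L ^ 2) = 0)
    (Z : Finset ℝ) :
    ∀ R ≤ 1, (∀ x ∈ Ioo L R, 0 < χ - c ^ 2 * x ^ 2) →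
    ContinuousOn (fun x => (1 - x ^ 2) * f1 x / √(χ - c ^ 2 * x ^ 2)) (Icc L R) →
    (1 - R ^ 2) * f1 R / √(χ - c ^ 2 * R ^ 2) = 0 →
    (∀ z ∈ Z, z ∈ Ioo L R ∧ f z = 0 ∧ f1 z ≠ 0) → Z.Nonempty → Z.card * π < c * (R - L) := by
  induction Z using Finset.induction_on_max with
  | empty => intro R _ _ _ _ _ hne; simp at hne
  | insert z Z hmax ih =>
    intro R hR hr hvc hvR hZ _
    have hzn : z ∉ Z := fun hz => lt_irrefl _ (hmax z hz)
    have hz := hZ z (Finset.mem_insert_self _ _)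
    rw [Finset.card_insert_of_notMem hzn]
    rcases Z.eq_empty_or_nonempty with rfl | hne
    · have := h.long hc hχ hL hR hr hvc hz.1 hz.2.2 hvL hvR
      simpa using this
    · set z' := Z.max' hne with hz'
      have hz'm : z' ∈ Z := Z.max'_mem hne
      have hz'Z := hZ z' (Finset.mem_insert_of_mem hz'm)
      have hlt : z' < z := hmax z' hz'm
      obtain ⟨ξ, hξ, hξ0⟩ := exists_hasDerivAt_eq_zero hlt
        (fun x _ => (h.d1 x).continuousAt.continuousWithinAt) (hz'Z.2.1.trans hz.2.1.symm)
        (fun x _ => h.d1 x)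
      have hLξ : L < ξ := by linarith [hz'Z.1.1, hξ.1]
      have hξR : ξ < R := by linarith [hz.1.2, hξ.2]
      have hvξ : (1 - ξ ^ 2) * f1 ξ / √(χ - c ^ 2 * ξ ^ 2) = 0 := by simp [hξ0]
      have h1 := ih ξ (by linarith) (fun x hx => hr x ⟨hx.1, by linarith [hx.2]⟩)
        (hvc.mono (Icc_subset_Icc le_rfl hξR.le)) hvξ
        (fun t ht => ⟨⟨(hZ t (Finset.mem_insert_of_mem ht)).1.1,
          lt_of_le_of_lt (Z.le_max' t ht) hξ.1⟩, (hZ t (Finset.mem_insert_of_mem ht)).2⟩) hne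
      have h2 := h.long hc hχ (by linarith) hR (fun x hx => hr x ⟨by linarith [hx.1], hx.2⟩)
        (hvc.mono (Icc_subset_Icc hLξ.le le_rfl)) ⟨hξ.2, hz.1.2⟩ hz.2.2 hvξ hvR
      push_cast
      nlinarith

theorem chi_vs_c_sq
    (c : ℝ) (hc : 0 < c)
    (n : ℕ) (hn : 2 ≤ n)
    (ψn : ℝ → ℝ) (lamn : ℂ) (χn : ℝ)
    (hnd : ProlateDatum c n ψn lamn χn) :
    ((n : ℝ) ≤ 2*c/π - 1 → χn < c^2) ∧ ((n : ℝ) ≥ 2*c/π → χn > c^2) := by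
  have hpi := pi_pos
  have h : PSol c χn ψn (deriv ψn) (deriv (deriv ψn)) :=
    { d1 := fun x => (hnd.analytic x).differentiableAt.hasDerivAt
      d2 := fun x => (hnd.analytic x).deriv.differentiableAt.hasDerivAt
      eq := hnd.diff_eq }
  have hfc : Continuous ψn := continuous_iff_continuousAt.2 fun x => (h.d1 x).continuousAt
  have hfc1 : Continuous (deriv ψn) := continuous_iff_continuousAt.2 fun x => (h.d2 x).continuousAt
  have hfin : {x : ℝ | x ∈ Ioo (-1 : ℝ) 1 ∧ ψn x = 0}.Finite :=
    Set.finite_of_encard_eq_coe hnd.zeros_card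
  obtain ⟨Z, hZ⟩ : ∃ Z : Finset ℝ, (Z : Set ℝ) = {x : ℝ | x ∈ Ioo (-1 : ℝ) 1 ∧ ψn x = 0} :=
    ⟨hfin.toFinset, hfin.coe_toFinset⟩
  have hcard : Z.card = n := by
    have := hnd.zeros_card
    rw [← hZ, Set.encard_coe_eq_coe_finsetCard] at this
    exact_mod_cast this
  have hmem : ∀ x, x ∈ Z ↔ x ∈ Ioo (-1 : ℝ) 1 ∧ ψn x = 0 := by
    intro x
    rw [← Finset.mem_coe, hZ]; rfl
  constructor
  · intro hle
    by_contra hcon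
    push Not at hcon
    -- pigeonhole
    have hn0 : (0 : ℝ) < n + 1 := by positivity
    have hex : ∃ j ∈ Finset.range (n + 1), ∀ x ∈ Ioo (-1 + 2 * (j : ℝ) / (n + 1))
        (-1 + 2 * ((j : ℝ) + 1) / (n + 1)), ψn x ≠ 0 := by
      by_contra hno
      push Not at hno
      choose! g hg hg0 using hno
      have hinj : Set.InjOn g (Finset.range (n + 1) : Set ℕ) := by
        have aux : ∀ i j, i ∈ Finset.range (n + 1) → j ∈ Finset.range (n + 1) → i < j → g i < g j := by
          intro i j hi hj hij
          have h1 := (hg i hi).2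
          have h2 := (hg j hj).1
          have h3 : (i : ℝ) + 1 ≤ j := by exact_mod_cast hij
          have h4 : 2 * ((i : ℝ) + 1) / (n + 1) ≤ 2 * (j : ℝ) / (n + 1) := by gcongr
          linarith
        intro i hi j hj hij
        rcases lt_trichotomy i j with hlt | heq | hlt
        · have := aux i j hi hj hlt; linarith
        · exact heq
        · have := aux j i hj hi hlt; linarith
      have hmaps : ∀ j ∈ Finset.range (n + 1), g j ∈ Z := by
        intro j hj
        rw [hmem]
        refine ⟨⟨?_, ?_⟩, hg0 j hj⟩
        · have : 0 ≤ 2 * (j : ℝ) / (n + 1) := by positivity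
          linarith [(hg j hj).1]
        · have h3 : (j : ℝ) + 1 ≤ n + 1 := by exact_mod_cast Finset.mem_range.1 hj
          have : 2 * ((j : ℝ) + 1) / (n + 1) ≤ 2 := by
            rw [div_le_iff₀ hn0]; linarith
          linarith [(hg j hj).2]
      have := Finset.card_le_card_of_injOn g hmaps hinj
      rw [Finset.card_range, hcard] at this
      omega
    obtain ⟨j, hj, hjx⟩ := hex
    have h3 : (j : ℝ) + 1 ≤ n + 1 := by exact_mod_cast Finset.mem_range.1 hj
    have key := h.short hc hcon (by gcongr; linarith)
      (by have : 0 ≤ 2 * (j : ℝ) / (n + 1) := by positivity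
          linarith)
      (by have : 2 * ((j : ℝ) + 1) / (n + 1) ≤ 2 := by
            rw [div_le_iff₀ hn0]; linarith
          linarith) hjx
    have e : c * (-1 + 2 * ((j : ℝ) + 1) / (n + 1) - (-1 + 2 * (j : ℝ) / (n + 1))) = 2 * c / (n + 1) := by
      field_simp; ring
    rw [e, div_lt_iff₀ hn0] at key
    have : (n : ℝ) + 1 ≤ 2 * c / π := by linarith
    rw [le_div_iff₀ hpi] at this
    linarith
  · intro hge
    by_contra hcon
    push Not at hcon
    have hne : Z.Nonempty := by
      rw [← Finset.card_pos]; omega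
    have hzs : ∀ z ∈ Z, ψn z = 0 ∧ deriv ψn z ≠ 0 := fun z hz =>
      ⟨((hmem z).1 hz).2, h.deriv_ne ((hmem z).1 hz).1 hfin ((hmem z).1 hz).2⟩
    have hfinal : ∀ L R, -1 ≤ L → R ≤ 1 → Z.card * π < c * (R - L) → False := by
      intro L R hL hR hlt
      rw [hcard] at hlt
      have : 2 * c ≤ n * π := by rwa [ge_iff_le, div_le_iff₀ hpi] at hge
      nlinarith
    rcases eq_or_lt_of_le hcon with heq | hlt
    · -- χ = c²
      have hrr : ∀ x : ℝ, χn - c ^ 2 * x ^ 2 = c ^ 2 * (1 - x ^ 2) := by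
        intro x; rw [heq]; ring
      have hv : ∀ x ∈ Icc (-1 : ℝ) 1, (1 - x ^ 2) * deriv ψn x / √(χn - c ^ 2 * x ^ 2)
          = √(1 - x ^ 2) * deriv ψn x / c := by
        intro x _
        rw [hrr, sqrt_mul (by positivity), sqrt_sq hc.le]
        have e : (1 - x ^ 2) * deriv ψn x / (c * √(1 - x ^ 2))
            = ((1 - x ^ 2) / √(1 - x ^ 2)) * deriv ψn x / c := by
          rw [div_eq_mul_inv, div_eq_mul_inv, div_eq_mul_inv, mul_inv]; ring
        rw [e, div_sqrt]
      refine hfinal (-1) 1 le_rfl le_rfl (h.count hc hcon le_rfl (by norm_num) Z 1 le_rfl ?_ ?_ (by norm_num) ?_ hne)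
      · intro x hx
        rw [hrr]
        have : 0 < 1 - x ^ 2 := by nlinarith [hx.1, hx.2]
        positivity
      · apply ContinuousOn.congr _ hv
        fun_prop
      · intro z hz
        exact ⟨((hmem z).1 hz).1, hzs z hz⟩
    · set z1 := Z.max' hne with hz1
      set z0 := Z.min' hne with hz0
      have hz1m : z1 ∈ Z := Z.max'_mem hne
      have hz0m : z0 ∈ Z := Z.min'_mem hne
      have hz1I := ((hmem z1).1 hz1m).1
      have hz0I := ((hmem z0).1 hz0m).1
      obtain ⟨R, hzR, hRT, hR0⟩ := h.exists_right hc hlt hz1I (hzs z1 hz1m).2 (hzs z1 hz1m).1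
        (by
          intro x hx h0
          have := Z.le_max' x ((hmem x).2 ⟨⟨by linarith [hx.1, hz1I.1], hx.2⟩, h0⟩)
          linarith [hx.1])
      obtain ⟨L', hzL, hLT, hL0⟩ := h.refl.exists_right hc hlt (z := -z0)
        ⟨by linarith [hz0I.2], by linarith [hz0I.1]⟩
        (by simpa using (hzs z0 hz0m).2) (by simpa using (hzs z0 hz0m).1)
        (by
          intro x hx h0
          have := Z.min'_le (-x) ((hmem (-x)).2 ⟨⟨by linarith [hx.2], by linarith [hx.1, hz0I.2]⟩, h0⟩)
          linarith [hx.1])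
      have hL0' : deriv ψn (-L') = 0 := by simpa using hL0
      have hT1 : √χn / c < 1 := by
        rw [div_lt_one hc, sqrt_lt' hc]; exact hlt
      have hr : ∀ x ∈ Icc (-L') R, 0 < χn - c ^ 2 * x ^ 2 := by
        intro x hx
        have h1 : |x| < √χn / c := abs_lt.2 ⟨by linarith [hx.1], by linarith [hx.2]⟩
        rw [lt_div_iff₀ hc, lt_sqrt (by positivity), mul_pow, sq_abs] at h1
        linarith
      refine hfinal (-L') R (by linarith) (by linarith) (h.count hc hcon (by linarith) (by simp [hL0']) Z R
        (by linarith) (fun x hx => hr x ⟨hx.1.le, hx.2.le⟩) ?_ (by simp [hR0]) ?_ hne)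
      · apply ContinuousOn.div (by fun_prop) (by fun_prop)
        intro x hx
        exact (sqrt_pos.2 (hr x hx)).ne'
      · intro z hz
        refine ⟨⟨?_, ?_⟩, hzs z hz⟩
        · have := Z.min'_le z hz; linarith
        · have := Z.le_max' z hz; linarith
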